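/- Let A be a real m×n matrix, σ > 0, λ > 0, and ẑ ∈ ℝⁿ, and let B = eᵀ be the 1×n all-ones row vector (sum-to-zero constraint, s = 1). Let Q̂ = diag(q̂) with q̂ᵢ = 1 if |ẑᵢ| > σλ and q̂ᵢ = 0 otherwise. If there exists an index i with |ẑᵢ| > σλ, then the constraint nondegeneracy condition holds at ẑ (eᵀQ̂ has rank 1), and consequently for every (u, v) ∈ ℝ^m × ℝ with (u, v) ≠ (0, 0), one has ‖u‖² + σ·⟨Q̂(Aᵀu − v·e), Aᵀu − v·e⟩ > 0, i.e., the block matrix [[I_m, 0],[0, 0]] + σ·[A; −eᵀ]·Q̂·[Aᵀ, −e] is positive definite. -/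

import Mathlib

open Matrix

/-- Euclidean norm on `Fin n → ℝ`. -/
noncomputable def euclNorm {n : ℕ} (x : Fin n → ℝ) : ℝ := Real.sqrt (∑ i, x i ^ 2)

/-- Euclidean inner product on `Fin n → ℝ`. -/
def dotp {n : ℕ} (x y : Fin n → ℝ) : ℝ := ∑ i, x i * y i

/-- ℓ₁ norm on `Fin n → ℝ`. -/
def l1norm {n : ℕ} (x : Fin n → ℝ) : ℝ := ∑ i, |x i|

/-- Euclidean distance from a point to a set: `inf_{y ∈ S} ‖x − y‖`. -/
noncomputable def distSet {n : ℕ} (x : Fin n → ℝ) (S : Set (Fin n → ℝ)) : ℝ :=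
  sInf ((fun y => euclNorm (x - y)) '' S)

/-- Subdifferential of a (convex) function `g` at `x`. -/
def subdiff {n : ℕ} (g : (Fin n → ℝ) → ℝ) (x : Fin n → ℝ) : Set (Fin n → ℝ) :=
  {s : Fin n → ℝ | ∀ y, g y ≥ g x + dotp s (y - x)}

lemma euclNorm_sq {n : ℕ} (x : Fin n → ℝ) : euclNorm x ^ 2 = x ⬝ᵥ x := by
  rw [euclNorm, Real.sq_sqrt (Finset.sum_nonneg fun i _ => sq_nonneg (x i))]
  simp only [dotProduct, sq]

lemma rank_eq_one_of_ne_zero {n : ℕ} {M : Matrix (Fin 1) (Fin n) ℝ} (hM : M ≠ 0) :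
    M.rank = 1 := by
  refine le_antisymm M.rank_le_height (Nat.one_le_iff_ne_zero.mpr fun h => hM ?_)
  rw [Matrix.rank, Submodule.finrank_eq_zero, LinearMap.range_eq_bot] at h
  exact Matrix.ext_iff_mulVec.mpr fun v => by simpa using LinearMap.congr_fun h v

lemma sum_to_zero_quadForm_pos {m n : ℕ} (A : Matrix (Fin m) (Fin n) ℝ) {σ : ℝ} (hσ : 0 < σ)
    {q : Fin n → ℝ} (hq : ∀ i, 0 ≤ q i) (hex : ∃ i, 0 < q i)
    (u : Fin m → ℝ) (v : ℝ) (huv : ¬(u = 0 ∧ v = 0)) :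
    0 < euclNorm u ^ 2 + σ * dotp (diagonal q *ᵥ (Aᵀ *ᵥ u - v • fun _ => 1))
      (Aᵀ *ᵥ u - v • fun _ => 1) := by
  have key (w : Fin n → ℝ) : dotp (diagonal q *ᵥ w) w = ∑ i, q i * w i ^ 2 :=
    Finset.sum_congr rfl fun i _ => by rw [mulVec_diagonal]; ring
  have hterm (w : Fin n → ℝ) (i : Fin n) : 0 ≤ q i * w i ^ 2 := mul_nonneg (hq i) (sq_nonneg _)
  rw [key, euclNorm_sq]
  by_cases hu : u = 0
  · subst hu
    have hv : v ≠ 0 := fun h => huv ⟨rfl, h⟩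
    obtain ⟨i, hi⟩ := hex
    have hsum : 0 < ∑ i, q i * (Aᵀ *ᵥ (0 : Fin m → ℝ) - v • (fun _ => 1 : Fin n → ℝ)) i ^ 2 := by
      refine Finset.sum_pos' (fun i _ => hterm _ i) ⟨i, Finset.mem_univ i, ?_⟩
      simp only [mulVec_zero, zero_sub, Pi.neg_apply, Pi.smul_apply, smul_eq_mul, mul_one, neg_sq]
      positivity
    simpa using mul_pos hσ hsum
  · have h : 0 < u ⬝ᵥ u := by simpa using dotProduct_star_self_pos_iff.mpr hu
    exact add_pos_of_pos_of_nonneg h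
      (mul_nonneg hσ.le (Finset.sum_nonneg fun i _ => hterm _ i))

lemma dotProduct_sum_to_zero_mulVec {m n : ℕ} (A : Matrix (Fin m) (Fin n) ℝ) (σ : ℝ)
    (Q : Matrix (Fin n) (Fin n) ℝ) (u : Fin m → ℝ) (v : Fin 1 → ℝ) :
    Sum.elim u v ⬝ᵥ ((fromBlocks (1 : Matrix (Fin m) (Fin m) ℝ) 0 0
        (0 : Matrix (Fin 1) (Fin 1) ℝ)
      + σ • (fromRows A (-of fun _ _ => 1) * Q * (fromRows A (-of fun _ _ => 1))ᵀ)) *ᵥ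
        Sum.elim u v) =
    euclNorm u ^ 2 + σ * dotp (Q *ᵥ (Aᵀ *ᵥ u - v 0 • fun _ => 1))
      (Aᵀ *ᵥ u - v 0 • fun _ => 1) := by
  have hw : (fromRows A (-of fun _ _ => 1))ᵀ *ᵥ Sum.elim u v = Aᵀ *ᵥ u - v 0 • fun _ => 1 := by
    rw [transpose_fromRows, fromCols_mulVec_sumElim, sub_eq_add_neg]
    congr 1
    ext i
    simp [mulVec, dotProduct]
  rw [add_mulVec, dotProduct_add, smul_mulVec, dotProduct_smul, ← mulVec_mulVec, ← mulVec_mulVec,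
    hw, dotProduct_mulVec _ (fromRows A _), ← mulVec_transpose, hw, euclNorm_sq, smul_eq_mul]
  simp [fromBlocks_mulVec, dotp, dotProduct, mul_comm]

/-- **Sum-to-zero constraint case** (Corollary 1): with `B = eᵀ` the all-ones row
(`s = 1`) and `Q̂ = diag(q̂)`, `q̂ᵢ = 1` if `|ẑᵢ| > σλ` and `0` otherwise, if some index
`i` satisfies `|ẑᵢ| > σλ`, then the constraint nondegeneracy condition holds at `ẑ`
(`eᵀQ̂` has rank 1) and consequently
`‖u‖² + σ⟨Q̂(Aᵀu − v·e), Aᵀu − v·e⟩ > 0` for all `(u, v) ≠ (0, 0)`, i.e. the block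
matrix `[[I,0],[0,0]] + σ[A;−eᵀ] Q̂ [Aᵀ,−e]` is positive definite. -/
theorem sum_to_zero_constraint_nondegenerate_posDef
    {m n : ℕ} (A : Matrix (Fin m) (Fin n) ℝ)
    (σ lam : ℝ) (hσ : 0 < σ) (hlam : 0 < lam)
    (zhat : Fin n → ℝ)
    (Qhat : Matrix (Fin n) (Fin n) ℝ)
    (hQhat : Qhat = Matrix.diagonal (fun i => if σ * lam < |zhat i| then (1 : ℝ) else 0))
    (B : Matrix (Fin 1) (Fin n) ℝ) (hB : B = Matrix.of fun _ _ => (1 : ℝ))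
    (e : Fin n → ℝ) (he : e = fun _ => 1)
    (hex : ∃ i, σ * lam < |zhat i|) :
    (B * Qhat).rank = 1 ∧
    (∀ (u : Fin m → ℝ) (v : ℝ), ¬(u = 0 ∧ v = 0) →
      0 < euclNorm u ^ 2
        + σ * dotp (Qhat *ᵥ (Aᵀ *ᵥ u - v • e)) (Aᵀ *ᵥ u - v • e)) ∧
    (Matrix.fromBlocks (1 : Matrix (Fin m) (Fin m) ℝ) 0 0
        (0 : Matrix (Fin 1) (Fin 1) ℝ)
      + σ • (Matrix.fromRows A (-B) * Qhat * (Matrix.fromRows A (-B))ᵀ)).PosDef := by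
  subst hQhat hB he
  obtain ⟨i, hi⟩ := hex
  have hpos := sum_to_zero_quadForm_pos A hσ
    (q := fun i => if σ * lam < |zhat i| then (1 : ℝ) else 0)
    (fun i => by split_ifs <;> simp) ⟨i, by simp [hi]⟩
  refine ⟨rank_eq_one_of_ne_zero fun h => ?_, hpos, .of_dotProduct_mulVec_pos ?_ fun x hx => ?_⟩
  · simpa [mul_diagonal, hi] using congrFun (congrFun h 0) i
  · rw [IsHermitian, conjTranspose_eq_transpose_of_trivial]
    simp only [transpose_add, transpose_smul, transpose_mul, transpose_transpose,
      diagonal_transpose, fromBlocks_transpose, transpose_one, transpose_zero, Matrix.mul_assoc]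
  · rw [star_trivial, ← Sum.elim_comp_inl_inr x, dotProduct_sum_to_zero_mulVec]
    refine hpos _ _ fun ⟨hu, hv⟩ => hx ?_
    ext (j | j)
    · exact congrFun hu j
    · rw [Subsingleton.elim j 0]
      exact hv
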